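/- Let σ_min ∈ (0, 1), t ∈ (0, 1], σ_t := 1 − (1 − σ_min)t (so σ_t > 0), μ̂ ∈ ℝ, σ̂ > 0, and let N[μ, σ²](x) = (2πσ²)^{−1/2} exp(−(x − μ)²/(2σ²)). Then for all θ ∈ ℝ: ∫_ℝ ((θ₁ − (1 − σ_min)θ)/σ_t) · N[t·θ₁, σ_t²](θ) · N[μ̂, σ̂²](θ₁) dθ₁ = (((σ_t² + t²σ̂² − σ_t)θ + t·μ̂·σ_t) / (t·(σ_t² + t²σ̂²))) · N[t·μ̂, σ_t² + t²σ̂²](θ). In other words, marginalizing the sample-conditional vector field u_t(θ|θ₁) = (θ₁ − (1 − σ_min)θ)/σ_t against p_t(θ|θ₁)·N[μ̂,σ̂²](θ₁)/p_t(θ), with p_t(θ|θ₁) = N[t·θ₁, σ_t²](θ) and p_t(θ) = N[t·μ̂, σ_t² + t²σ̂²](θ), gives the marginal vector field u_t(θ) = ((σ_t² + t²σ̂² − σ_t)θ + t·μ̂·σ_t) / (t·(σ_t² + t²σ̂²)). -/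

import Mathlib

open MeasureTheory Real

/-- The one-dimensional Gaussian probability density with mean `μ` and variance `v`. -/
noncomputable def gaussDensity (μ v x : ℝ) : ℝ :=
  (Real.sqrt (2 * Real.pi * v))⁻¹ * Real.exp (-(x - μ) ^ 2 / (2 * v))

/-- Completing the square: the product of a Gaussian likelihood with linear mean and a Gaussian
prior is the marginal density times the posterior density. -/
lemma gaussDensity_mul_gaussDensity {s v : ℝ} (hs : 0 < s) (hv : 0 < v) (t μ x y : ℝ) :
    gaussDensity (t * y) s x * gaussDensity μ v y =
      gaussDensity (t * μ) (s + t ^ 2 * v) x *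
        gaussDensity ((s * μ + t * v * x) / (s + t ^ 2 * v)) (s * v / (s + t ^ 2 * v)) y := by
  have hS : 0 < s + t ^ 2 * v := by positivity
  unfold gaussDensity
  rw [mul_mul_mul_comm, mul_mul_mul_comm (√(2 * π * (s + t ^ 2 * v)))⁻¹, ← mul_inv, ← mul_inv,
    ← Real.sqrt_mul (by positivity),
    ← Real.sqrt_mul (by positivity), ← Real.exp_add, ← Real.exp_add]
  congr 1
  · congr 2
    field_simp
  · congr 1
    field_simp
    ring

/-- The integral of an affine function against a Gaussian density is its value at the mean. -/
lemma integral_sub_mul_gaussDensity {v : ℝ} (hv : 0 < v) (m c : ℝ) :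
    ∫ y : ℝ, (y - c) * gaussDensity m v y = m - c := by
  lift v to NNReal using hv.le
  have hv' : v ≠ 0 := by rintro rfl; simp at hv
  have hint : Integrable (fun y : ℝ ↦ y) (ProbabilityTheory.gaussianReal m v) :=
    (ProbabilityTheory.memLp_id_gaussianReal 1).integrable le_rfl
  have h : ∫ y, (y - c) ∂(ProbabilityTheory.gaussianReal m v) = m - c := by
    rw [integral_sub hint (integrable_const c), ProbabilityTheory.integral_id_gaussianReal]
    simp
  rw [← h, ProbabilityTheory.integral_gaussianReal_eq_integral_smul hv']
  refine integral_congr_ae (.of_forall fun y ↦ ?_)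
  simp only [smul_eq_mul, gaussDensity, ProbabilityTheory.gaussianPDFReal_def]
  ring

/-- Marginalizing the sample-conditional vector field
`u_t(θ|θ₁) = (θ₁ − (1 − σ_min)θ)/σ_t` of the optimal transport path against
`p_t(θ|θ₁)·N[μ̂,σ̂²](θ₁)` yields `u_t(θ)·p_t(θ)` with the marginal vector field
`u_t(θ) = ((σ_t² + t²σ̂² − σ_t)θ + t·μ̂·σ_t) / (t·(σ_t² + t²σ̂²))`. -/
theorem gauss_marginal_vector_field (σmin t σt μhat σhat θ : ℝ)
    (hσmin : σmin ∈ Set.Ioo (0 : ℝ) 1) (ht : t ∈ Set.Ioc (0 : ℝ) 1)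
    (hσt : σt = 1 - (1 - σmin) * t) (hσtpos : 0 < σt) (hσhat : 0 < σhat) :
    ∫ θ₁ : ℝ, (θ₁ - (1 - σmin) * θ) / σt * gaussDensity (t * θ₁) (σt ^ 2) θ *
        gaussDensity μhat (σhat ^ 2) θ₁
      = ((σt ^ 2 + t ^ 2 * σhat ^ 2 - σt) * θ + t * μhat * σt) /
          (t * (σt ^ 2 + t ^ 2 * σhat ^ 2)) *
          gaussDensity (t * μhat) (σt ^ 2 + t ^ 2 * σhat ^ 2) θ := by
  have ht0 : 0 < t := ht.1
  have hS : 0 < σt ^ 2 + t ^ 2 * σhat ^ 2 := by positivity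
  have hc : 1 - σmin = (1 - σt) / t := by rw [hσt]; field_simp; ring
  have hprod (y : ℝ) :=
    gaussDensity_mul_gaussDensity (pow_pos hσtpos 2) (pow_pos hσhat 2) t μhat θ y
  calc
    _ = ∫ y : ℝ, gaussDensity (t * μhat) (σt ^ 2 + t ^ 2 * σhat ^ 2) θ / σt *
          ((y - (1 - σmin) * θ) *
            gaussDensity ((σt ^ 2 * μhat + t * σhat ^ 2 * θ) / (σt ^ 2 + t ^ 2 * σhat ^ 2))
              (σt ^ 2 * σhat ^ 2 / (σt ^ 2 + t ^ 2 * σhat ^ 2)) y) := by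
      refine integral_congr_ae (.of_forall fun y ↦ ?_)
      simp only [mul_assoc ((y - (1 - σmin) * θ) / σt), hprod y]
      ring
    _ = _ := by
      rw [integral_const_mul, integral_sub_mul_gaussDensity (by positivity), hc]
      field_simp
      ring
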